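/- Triangle gadget: There is a universal constant c₀ > 0 with the following property. Let R be a register of qubits, H_else Hermitian on R, and let P_A, P_B, P_C be Hermitian involutions (P² = I) acting on three distinct qubits of R, and let α_ab, α_ac be real numbers. Adjoin one ancilla qubit t and define H₀ := |1⟩⟨1|_t, H₁ := H_else + α_ab·α_ac·P_B·P_C + (1/2)(1 + α_ab² + α_ac²)·I, and H₂ := (1/√2)(−P_A + α_ab·P_B + α_ac·P_C)⊗X_t. Then for all ε, η ∈ (0,1] and all Δ ≥ c₀(Λ⁶/ε² + Λ²/η²), where Λ := max(‖H₁‖, ‖H₂‖, 1), the Hamiltonian H̃ := Δ·H₀ + H₁ + √Δ·H₂ is a (Δ/2, η, ε)-simulation of H_target := H_else + α_ab·P_A·P_B + α_ac·P_A·P_C with product encoding, with ancilla state |anc⟩ = |0⟩_t. In this simulation, qubit A interacts only with the new ancilla t, so the degree of qubit A in the interaction graph decreases. -/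

import Mathlib

open Matrix
open scoped Kronecker ComplexOrder

namespace QSim

/-- Index set for the computational basis of `n` qubits. -/
abbrev QIdx (n : ℕ) := Fin n → Fin 2

/-- Operators (matrices) on the Hilbert space of `n` qubits. -/
abbrev QOp (n : ℕ) := Matrix (QIdx n) (QIdx n) ℂ

/-- The operator (`ℓ²→ℓ²`) norm of a (possibly rectangular) matrix. -/
noncomputable def opNorm {I J : Type*} [Fintype I] [Fintype J] [DecidableEq J]
    (M : Matrix I J ℂ) : ℝ :=
  ‖LinearMap.toContinuousLinearMap (Matrix.toEuclideanLin M)‖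

/-- A two-qubit operator `E` placed on qubits `i` and `j` of an `n`-qubit register
(identity elsewhere), given entrywise. -/
def twoQubitOp (n : ℕ) (i j : Fin n) (E : Fin 2 → Fin 2 → Fin 2 → Fin 2 → ℂ) : QOp n :=
  fun x y => E (x i) (x j) (y i) (y j) * (if ∀ k, k ≠ i → k ≠ j → x k = y k then 1 else 0)

/-- A single-qubit operator `E` placed on qubit `i` of an `n`-qubit register. -/
def oneQubitOp (n : ℕ) (i : Fin n) (E : Matrix (Fin 2) (Fin 2) ℂ) : QOp n :=
  fun x y => E (x i) (y i) * (if ∀ k, k ≠ i → x k = y k then 1 else 0)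

/-- Sign used to build `(|01⟩ - |10⟩)/√2`. -/
def sgnE (a b : Fin 2) : ℂ :=
  if a = 0 ∧ b = 1 then 1 else if a = 1 ∧ b = 0 then -1 else 0

/-- Entries of the two-qubit projector `P` onto `span{(|01⟩-|10⟩)/√2, |11⟩}`:
`P = (1/2)(|01⟩-|10⟩)(⟨01|-⟨10|) + |11⟩⟨11|`. -/
noncomputable def Pentry (a b c d : Fin 2) : ℂ :=
  (1 / 2) * sgnE a b * sgnE c d + (if a = 1 ∧ b = 1 ∧ c = 1 ∧ d = 1 then 1 else 0)

/-- `H_{W,0} = Σ_{i=1}^{n-1} P_{i,i+1}`. -/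
noncomputable def HW0 (n : ℕ) : QOp n :=
  ∑ i : Fin (n - 1),
    twoQubitOp n ⟨i.1, by have := i.2; omega⟩ ⟨i.1 + 1, by have := i.2; omega⟩ Pentry

/-- The all-zeros state `|0…0⟩`. -/
def ket0 (n : ℕ) : QIdx n → ℂ := fun x => if ∀ k, x k = 0 then 1 else 0

/-- The generalized W state `|W_n⟩ = n^{-1/2} Σ_i |e_i⟩`. -/
noncomputable def Wstate (n : ℕ) : QIdx n → ℂ := fun x =>
  if (Finset.univ.filter fun k => x k = 1).card = 1 then (((Real.sqrt n)⁻¹ : ℝ) : ℂ) else 0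

end QSim

namespace QSim

/-- The Pauli `Z` matrix. -/
noncomputable def Zmat : Matrix (Fin 2) (Fin 2) ℂ := !![1, 0; 0, -1]

/-- The Pauli `X` matrix. -/
noncomputable def Xmat : Matrix (Fin 2) (Fin 2) ℂ := !![0, 1; 1, 0]

/-- The W-state parent Hamiltonian `H_W = Γ·H_{W,0} + 1 - Σ_{i=1}^n (1 - Z_i)/2`. -/
noncomputable def HWham (n : ℕ) (Γ : ℝ) : QOp n :=
  (Γ : ℂ) • HW0 n + 1 - ∑ i : Fin n, oneQubitOp n i ((1 - Zmat) / 2)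

end QSim

namespace QSim

open scoped Classical in
/-- The spectral projector of a Hermitian matrix onto the span of its eigenvectors with
eigenvalue strictly below `Δ` (junk value `0` if the matrix is not Hermitian). -/
noncomputable def specProjBelow {I : Type*} [Fintype I] [DecidableEq I]
    (M : Matrix I I ℂ) (Δ : ℝ) : Matrix I I ℂ :=
  if hM : M.IsHermitian then
    (hM.eigenvectorUnitary : Matrix I I ℂ) *
      Matrix.diagonal (fun k => if hM.eigenvalues k < Δ then (1 : ℂ) else 0) *
      (hM.eigenvectorUnitary : Matrix I I ℂ)ᴴ
  else 0

/-- The isometry `T : ψ ↦ ψ ⊗ |anc⟩` from `ℋ` into `ℋ⊗𝒜`, as a rectangular matrix. -/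
def prodIso {I J : Type*} [DecidableEq I] (anc : J → ℂ) : Matrix (I × J) I ℂ :=
  fun p i => if p.1 = i then anc p.2 else 0

/-- `H_s` (on `ℋ⊗𝒜`) is a `(Δ,η,ε)`-simulation of `H_t` (on `ℋ`) with product encoding,
witnessed by the isometry `T̃`: `|anc⟩` is a unit vector, `T̃` is an isometry with range the
eigenspace of `H_s` of energies `< Δ`, `‖T̃ - (·⊗|anc⟩)‖ ≤ η`, and
`‖P H_s P - T̃ H_t T̃†‖ ≤ ε` where `P` is the spectral projector below `Δ`. -/
noncomputable def IsSimulationWith {I J : Type*} [Fintype I] [DecidableEq I]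
    [Fintype J] [DecidableEq J]
    (Hs : Matrix (I × J) (I × J) ℂ) (Ht : Matrix I I ℂ) (anc : J → ℂ)
    (Tt : Matrix (I × J) I ℂ) (Δ η ε : ℝ) : Prop :=
  star anc ⬝ᵥ anc = 1 ∧
  Ttᴴ * Tt = 1 ∧
  Tt * Ttᴴ = specProjBelow Hs Δ ∧
  opNorm (Tt - prodIso anc) ≤ η ∧
  opNorm (specProjBelow Hs Δ * Hs * specProjBelow Hs Δ - Tt * Ht * Ttᴴ) ≤ ε

/-- `H_s` is a `(Δ,η,ε)`-simulation of `H_t` with product encoding (ancilla state `anc`). -/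
noncomputable def IsSimulation {I J : Type*} [Fintype I] [DecidableEq I]
    [Fintype J] [DecidableEq J]
    (Hs : Matrix (I × J) (I × J) ℂ) (Ht : Matrix I I ℂ) (anc : J → ℂ) (Δ η ε : ℝ) : Prop :=
  ∃ Tt : Matrix (I × J) I ℂ, IsSimulationWith Hs Ht anc Tt Δ η ε

end QSim

namespace QSim

/-- `M` acts nontrivially only on the qubits in `S` (i.e. `M = M_S ⊗ I` on the rest). -/
def ActsOn {ι : Type*} [Fintype ι] [DecidableEq ι]
    (M : Matrix (ι → Fin 2) (ι → Fin 2) ℂ) (S : Finset ι) : Prop :=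
  ∃ f : ({k // k ∈ S} → Fin 2) → ({k // k ∈ S} → Fin 2) → ℂ,
    ∀ x y, M x y
      = (if ∀ k ∉ S, x k = y k then 1 else 0) * f (fun k => x k.1) (fun k => y k.1)

/-- The projector `|0⟩⟨0|` on one qubit. -/
noncomputable def proj0 : Matrix (Fin 2) (Fin 2) ℂ := !![1, 0; 0, 0]

/-- The projector `|1⟩⟨1|` on one qubit. -/
noncomputable def proj1 : Matrix (Fin 2) (Fin 2) ℂ := !![0, 0; 0, 1]

/-- The state `|0⟩` of the ancilla qubit. -/
def anc0 : Fin 2 → ℂ := fun t => if t = 0 then 1 else 0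

end QSim

namespace QSim

theorem exists_riccati_solution {𝒜 : Type*} [CStarAlgebra 𝒜] {a b : 𝒜} {L s : ℝ}
    (hL : 1 ≤ L) (hs : 8 * L ≤ s) (ha : ‖a‖ ≤ L) (hb : ‖b‖ ≤ L) :
    ∃ w : 𝒜, ‖w‖ ≤ 2 * L / s ∧
      w = ((s : ℂ)⁻¹ ^ 2) • (w * a - a * w) + (s : ℂ)⁻¹ • (w * b * w - b) := by
  have hs0 : 0 < s := by linarith
  set t : ℝ := s⁻¹ with ht
  have ht0 : 0 < t := inv_pos.2 hs0
  have htL : L * t ≤ 1 / 8 := by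
    rw [ht, ← div_eq_mul_inv, div_le_iff₀ hs0]; linarith
  have ht1 : t ≤ 1 / 8 := le_trans (by nlinarith) htL
  have htc : ‖(s : ℂ)⁻¹‖ = t := by
    rw [norm_inv, Complex.norm_real, Real.norm_of_nonneg hs0.le]
  set r : ℝ := 2 * L / s with hr
  have hr' : r = 2 * (L * t) := by rw [hr, ht]; ring
  have hr0 : 0 ≤ r := by positivity
  have hr1 : r ≤ 1 / 4 := by linarith
  let F : 𝒜 → 𝒜 := fun w =>
    ((s : ℂ)⁻¹ ^ 2) • (w * a - a * w) + (s : ℂ)⁻¹ • (w * b * w - b)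
  have hmaps : Set.MapsTo F (Metric.closedBall 0 r) (Metric.closedBall 0 r) := by
    intro w hw
    rw [mem_closedBall_zero_iff] at hw ⊢
    have h1 : ‖w * a - a * w‖ ≤ 2 * (r * L) := by
      refine (norm_sub_le _ _).trans ?_
      have h1 := norm_mul_le_of_le hw ha
      have h2 := norm_mul_le_of_le ha hw
      linarith
    have h2 : ‖w * b * w - b‖ ≤ r * L * r + L :=
      (norm_sub_le _ _).trans
        (add_le_add (norm_mul_le_of_le (norm_mul_le_of_le hw hb) hw) hb)
    have h3 : ‖F w‖ ≤ t ^ 2 * (2 * (r * L)) + t * (r * L * r + L) := by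
      refine (norm_add_le _ _).trans (add_le_add ?_ ?_)
      · rw [norm_smul, norm_pow, htc]; gcongr
      · rw [norm_smul, htc]; gcongr
    refine h3.trans ?_
    have e1 : t ^ 2 * (2 * (r * L)) + t * (r * L * r + L)
        = r * (2 * t * (L * t) + r * (L * t) + 1 / 2) := by
      linear_combination (-1 / 2) * hr'
    rw [e1]
    refine mul_le_of_le_one_right hr0 ?_
    have : 0 ≤ L * t := by positivity
    nlinarith
  have hlip : ContractingWith (1 / 2) (hmaps.restrict F _ _) := by
    refine ⟨by norm_num, LipschitzWith.of_dist_le_mul ?_⟩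
    rintro ⟨w, hw⟩ ⟨v, hv⟩
    rw [mem_closedBall_zero_iff] at hw hv
    rw [Subtype.dist_eq, Subtype.dist_eq, dist_eq_norm, dist_eq_norm]
    simp only [Set.MapsTo.val_restrict_apply]
    have e : F w - F v = ((s : ℂ)⁻¹ ^ 2) • ((w - v) * a - a * (w - v))
        + (s : ℂ)⁻¹ • ((w - v) * b * w + v * b * (w - v)) := by
      simp only [F, ← smul_sub, add_sub_add_comm]
      congr 2 <;> noncomm_ring
    rw [e]
    have h1 : ‖(w - v) * a - a * (w - v)‖ ≤ ‖w - v‖ * L + L * ‖w - v‖ :=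
      (norm_sub_le _ _).trans
        (add_le_add (norm_mul_le_of_le le_rfl ha) (norm_mul_le_of_le ha le_rfl))
    have h2 : ‖(w - v) * b * w + v * b * (w - v)‖ ≤ ‖w - v‖ * L * r + r * L * ‖w - v‖ :=
      (norm_add_le _ _).trans
        (add_le_add (norm_mul_le_of_le (norm_mul_le_of_le le_rfl hb) hw)
          (norm_mul_le_of_le (norm_mul_le_of_le hv hb) le_rfl))
    calc _ ≤ t ^ 2 * (‖w - v‖ * L + L * ‖w - v‖)
          + t * (‖w - v‖ * L * r + r * L * ‖w - v‖) := by
          refine (norm_add_le _ _).trans (add_le_add ?_ ?_)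
          · rw [norm_smul, norm_pow, htc]; gcongr
          · rw [norm_smul, htc]; gcongr
      _ = (2 * t * (L * t) + 2 * r * (L * t)) * ‖w - v‖ := by ring
      _ ≤ _ := by
          gcongr
          have : 0 ≤ L * t := by positivity
          push_cast
          nlinarith
  obtain ⟨w, hw, hfix, -⟩ := hlip.exists_fixedPoint' Metric.isClosed_closedBall.isComplete
    hmaps (x := 0) (by simpa using hr0) (edist_ne_top _ _)
  exact ⟨w, by simpa using hw, hfix.symm⟩

theorem exists_sqrt_one_add_star_mul_self {𝒜 : Type*} [CStarAlgebra 𝒜] (w : 𝒜) :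
    ∃ S R : 𝒜, star S = S ∧ R * S = 1 ∧ R * R = 1 + star w * w ∧
      ‖S‖ ≤ 1 ∧ ‖S - 1‖ ≤ ‖w‖ ^ 2 ∧ ‖R - 1‖ ≤ ‖w‖ ^ 2 := by
  have hsa : IsSelfAdjoint (star w * w) := IsSelfAdjoint.star_mul_self w
  have hnn : ∀ x ∈ spectrum ℝ (star w * w), 0 ≤ x := spectrum_star_mul_self_nonneg
  have hle : ∀ x ∈ spectrum ℝ (star w * w), x ≤ ‖w‖ ^ 2 := by
    intro x hx
    rw [pow_two, ← CStarRing.norm_star_mul_self]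
    exact (le_abs_self x).trans
      (IsometricContinuousFunctionalCalculus.norm_spectrum_le (𝕜 := ℝ) _ hx)
  have hpos : ∀ x ∈ spectrum ℝ (star w * w), 1 ≤ √(1 + x) := fun x hx =>
    Real.one_le_sqrt.2 (by linarith [hnn x hx])
  have hsq : ∀ x ∈ spectrum ℝ (star w * w), √(1 + x) * √(1 + x) = 1 + x := fun x hx =>
    Real.mul_self_sqrt (by linarith [hnn x hx])
  have hcR : ContinuousOn (fun x : ℝ => √(1 + x)) (spectrum ℝ (star w * w)) := by fun_prop
  have hcS : ContinuousOn (fun x : ℝ => (√(1 + x))⁻¹) (spectrum ℝ (star w * w)) :=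
    hcR.inv₀ fun x hx => by linarith [hpos x hx]
  have hone : cfc (fun _ : ℝ => (1 : ℝ)) (star w * w) = 1 := cfc_const_one ℝ _
  refine ⟨cfc (fun x : ℝ => (√(1 + x))⁻¹) (star w * w), cfc (fun x : ℝ => √(1 + x)) (star w * w),
    (cfc_predicate (p := IsSelfAdjoint) _ _), ?_, ?_, ?_, ?_, ?_⟩
  · rw [← cfc_mul _ _ _ hcR hcS, ← hone]
    refine cfc_congr fun x hx => mul_inv_cancel₀ ?_
    linarith [hpos x hx]
  · rw [← cfc_mul _ _ _ hcR hcR]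
    rw [cfc_congr (g := fun x => 1 + x) hsq, cfc_const_add (1 : ℝ) (fun x => x) _, cfc_id' ℝ _]
    simp
  · refine norm_cfc_le zero_le_one fun x hx => ?_
    rw [Real.norm_of_nonneg (by positivity)]
    exact inv_le_one_of_one_le₀ (hpos x hx)
  · rw [← hone, ← cfc_sub _ _ _ hcS (by fun_prop)]
    refine norm_cfc_le (by positivity) fun x hx => ?_
    have h := hpos x hx
    have h1 : (√(1 + x))⁻¹ ≤ 1 := inv_le_one_of_one_le₀ h
    have h2 : 0 < (√(1 + x))⁻¹ := by positivity
    have h3 : √(1 + x) * (√(1 + x))⁻¹ = 1 := mul_inv_cancel₀ (by linarith)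
    rw [Real.norm_of_nonpos (by linarith)]
    nlinarith [hsq x hx, hle x hx, hnn x hx]
  · rw [← hone, ← cfc_sub _ _ _ hcR (by fun_prop)]
    refine norm_cfc_le (by positivity) fun x hx => ?_
    have h := hpos x hx
    rw [Real.norm_of_nonneg (by linarith)]
    nlinarith [hsq x hx, hle x hx, hnn x hx]

section EffectiveBlock

variable {𝒜 : Type*} [CStarAlgebra 𝒜] {a b w S R : 𝒜} {L s : ℝ}

theorem riccati_equation (hs : 0 < s)
    (hfix : w = ((s : ℂ)⁻¹ ^ 2) • (w * a - a * w) + (s : ℂ)⁻¹ • (w * b * w - b)) :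
    (s : ℂ) • b + ((s ^ 2 : ℝ) : ℂ) • w + a * w = w * (a + (s : ℂ) • (b * w)) := by
  have hsc : (s : ℂ) ≠ 0 := by exact_mod_cast hs.ne'
  have h := congrArg (fun x => ((s ^ 2 : ℝ) : ℂ) • x) hfix
  simp only [smul_add, smul_smul] at h
  have e1 : ((s ^ 2 : ℝ) : ℂ) * ((s : ℂ)⁻¹ ^ 2) = 1 := by push_cast; field_simp
  have e2 : ((s ^ 2 : ℝ) : ℂ) * (s : ℂ)⁻¹ = s := by push_cast; field_simp
  rw [e1, e2, one_smul, smul_sub] at h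
  rw [h, mul_add, mul_smul_comm, mul_assoc]
  abel

theorem norm_smul_mul_le (hL : 1 ≤ L) (hs : 8 * L ≤ s) (hb : ‖b‖ ≤ L) (hw : ‖w‖ ≤ 2 * L / s) :
    ‖(s : ℂ) • (b * w)‖ ≤ 2 * L ^ 2 := by
  have hs0 : 0 < s := by linarith
  rw [norm_smul, Complex.norm_real, Real.norm_of_nonneg hs0.le]
  calc s * ‖b * w‖ ≤ s * (L * (2 * L / s)) := by gcongr; exact norm_mul_le_of_le hb hw
    _ = 2 * L ^ 2 := by field_simp

theorem norm_sub_smul_mul_lt (hL : 1 ≤ L) (hs : 8 * L ≤ s) (ha : ‖a‖ ≤ L) (hb : ‖b‖ ≤ L)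
    (hw : ‖w‖ ≤ 2 * L / s) : ‖a - (s : ℂ) • (b * w)‖ < s ^ 2 / 2 := by
  have h := (norm_sub_le _ _).trans (add_le_add ha (norm_smul_mul_le hL hs hb hw))
  nlinarith

theorem norm_add_smul_mul_le (hL : 1 ≤ L) (hs : 8 * L ≤ s) (ha : ‖a‖ ≤ L) (hb : ‖b‖ ≤ L)
    (hw : ‖w‖ ≤ 2 * L / s) : ‖a + (s : ℂ) • (b * w)‖ ≤ 3 * L ^ 2 := by
  have h := (norm_add_le _ _).trans (add_le_add ha (norm_smul_mul_le hL hs hb hw))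
  nlinarith

theorem norm_conj_sub_le (hL : 1 ≤ L) (hs : 8 * L ≤ s) (ha : ‖a‖ ≤ L) (hb : ‖b‖ ≤ L)
    (hw : ‖w‖ ≤ 2 * L / s) (hS : ‖S‖ ≤ 1) (hSd : ‖S - 1‖ ≤ ‖w‖ ^ 2) (hRd : ‖R - 1‖ ≤ ‖w‖ ^ 2) :
    ‖R * (a + (s : ℂ) • (b * w)) * S - (a + (s : ℂ) • (b * w))‖ ≤ 24 * L ^ 4 / s ^ 2 := by
  have hK := norm_add_smul_mul_le hL hs ha hb hw
  generalize a + (s : ℂ) • (b * w) = K at *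
  have hw2 : ‖w‖ ^ 2 ≤ (2 * L / s) ^ 2 := by gcongr
  have e : R * K * S - K = (R - 1) * K * S + K * (S - 1) := by noncomm_ring
  rw [e]
  calc _ ≤ (2 * L / s) ^ 2 * (3 * L ^ 2) * 1 + 3 * L ^ 2 * (2 * L / s) ^ 2 :=
        (norm_add_le _ _).trans (add_le_add
          (norm_mul_le_of_le (norm_mul_le_of_le (hRd.trans hw2) hK) hS)
          (norm_mul_le_of_le hK (hSd.trans hw2)))
    _ = _ := by ring

theorem norm_conj_lt (hL : 1 ≤ L) (hs : 8 * L ≤ s) (ha : ‖a‖ ≤ L) (hb : ‖b‖ ≤ L)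
    (hw : ‖w‖ ≤ 2 * L / s) (hS : ‖S‖ ≤ 1) (hSd : ‖S - 1‖ ≤ ‖w‖ ^ 2) (hRd : ‖R - 1‖ ≤ ‖w‖ ^ 2) :
    ‖R * (a + (s : ℂ) • (b * w)) * S‖ < s ^ 2 / 2 := by
  have hs0 : 0 < s := by linarith
  have hK := norm_add_smul_mul_le hL hs ha hb hw
  have hd := norm_conj_sub_le hL hs ha hb hw hS hSd hRd
  have ht := norm_le_norm_sub_add (R * (a + (s : ℂ) • (b * w)) * S) (a + (s : ℂ) • (b * w))
  have hgap : 64 * L ^ 2 ≤ s ^ 2 := by nlinarith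
  have h1 : 24 * L ^ 4 / s ^ 2 ≤ L ^ 2 := by
    rw [div_le_iff₀ (by positivity)]
    nlinarith [sq_nonneg L]
  nlinarith

theorem norm_conj_sub_effective_le (hL : 1 ≤ L) (hs : 8 * L ≤ s) (ha : ‖a‖ ≤ L) (hb : ‖b‖ ≤ L)
    (hw : ‖w‖ ≤ 2 * L / s)
    (hfix : w = ((s : ℂ)⁻¹ ^ 2) • (w * a - a * w) + (s : ℂ)⁻¹ • (w * b * w - b))
    (hS : ‖S‖ ≤ 1) (hSd : ‖S - 1‖ ≤ ‖w‖ ^ 2) (hRd : ‖R - 1‖ ≤ ‖w‖ ^ 2) :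
    ‖R * (a + (s : ℂ) • (b * w)) * S - (a - b * b)‖ ≤ 32 * L ^ 4 / s ^ 2 := by
  have hs0 : 0 < s := by linarith
  have hsc : (s : ℂ) ≠ 0 := by exact_mod_cast hs0.ne'
  have hd := norm_conj_sub_le hL hs ha hb hw hS hSd hRd
  have h3 : (s : ℂ) • w = (s : ℂ)⁻¹ • (w * a - a * w) + (w * b * w - b) := by
    have h := congrArg (fun x => (s : ℂ) • x) hfix
    simp only [smul_add, smul_smul] at h
    have e1 : (s : ℂ) * ((s : ℂ)⁻¹ ^ 2) = (s : ℂ)⁻¹ := by field_simp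
    rwa [e1, mul_inv_cancel₀ hsc, one_smul] at h
  have h2 : a + (s : ℂ) • (b * w) - (a - b * b)
      = (s : ℂ)⁻¹ • (b * (w * a - a * w)) + b * (w * b * w) := by
    rw [← mul_smul_comm, h3, mul_add, mul_smul_comm, mul_sub b (w * b * w)]
    abel
  have h4 : ‖a + (s : ℂ) • (b * w) - (a - b * b)‖
      ≤ s⁻¹ * (L * (2 * L / s * L + L * (2 * L / s))) + L * (2 * L / s * L * (2 * L / s)) := by
    rw [h2]
    refine (norm_add_le _ _).trans (add_le_add ?_ ?_)
    · rw [norm_smul, norm_inv, Complex.norm_real, Real.norm_of_nonneg hs0.le]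
      gcongr
      exact norm_mul_le_of_le hb ((norm_sub_le _ _).trans
        (add_le_add (norm_mul_le_of_le hw ha) (norm_mul_le_of_le ha hw)))
    · exact norm_mul_le_of_le hb (norm_mul_le_of_le (norm_mul_le_of_le hw hb) hw)
  refine (norm_sub_le_norm_sub_add_norm_sub _ (a + (s : ℂ) • (b * w)) _).trans
    ((add_le_add hd h4).trans ?_)
  have e2 : 24 * L ^ 4 / s ^ 2
      + (s⁻¹ * (L * (2 * L / s * L + L * (2 * L / s))) + L * (2 * L / s * L * (2 * L / s)))
      = (28 * L ^ 4 + 4 * L ^ 3) / s ^ 2 := by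
    field_simp; ring
  rw [e2]
  gcongr
  nlinarith [pow_pos (zero_lt_one.trans_le hL) 3]

end EffectiveBlock

section Spectral

open scoped Matrix.Norms.L2Operator

variable {I J : Type*} [Fintype I] [DecidableEq I] [Fintype J] [DecidableEq J]

omit [DecidableEq I] in
theorem opNorm_eq_norm (M : Matrix I J ℂ) : opNorm M = ‖M‖ := rfl

theorem norm_le_norm_of_mulVec_eq_smul {K : Matrix I I ℂ} {x : I → ℂ} {c : ℂ}
    (h : K *ᵥ x = c • x) (hx : x ≠ 0) : ‖c‖ ≤ ‖K‖ := by
  have h1 := Matrix.l2_opNorm_mulVec K (WithLp.toLp 2 x)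
  change ‖WithLp.toLp 2 (K *ᵥ x)‖ ≤ _ at h1
  rw [h, WithLp.toLp_smul, norm_smul] at h1
  refine le_of_mul_le_mul_right h1 (norm_pos_iff.2 ?_)
  simpa using hx

theorem specProjBelow_eq {M Q : Matrix I I ℂ} (hM : M.IsHermitian) {D : ℝ}
    (hlt : ∀ (u : I → ℂ) (c : ℝ), M *ᵥ u = (c : ℂ) • u → c < D → Q *ᵥ u = u)
    (hge : ∀ (u : I → ℂ) (c : ℝ), M *ᵥ u = (c : ℂ) • u → D ≤ c → Q *ᵥ u = 0) :
    Q = specProjBelow M D := by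
  classical
  rw [specProjBelow, dif_pos hM]
  set U : Matrix I I ℂ := (hM.eigenvectorUnitary : Matrix I I ℂ) with hU
  have hUU : U * Uᴴ = 1 := Unitary.mul_star_self_of_mem hM.eigenvectorUnitary.2
  have key : Q * U = U * Matrix.diagonal (fun k => if hM.eigenvalues k < D then (1 : ℂ) else 0) := by
    ext i k
    have hcol : ∀ j, U j k = hM.eigenvectorBasis k j := fun j => rfl
    have heig : M *ᵥ ⇑(hM.eigenvectorBasis k)
        = ((hM.eigenvalues k : ℝ) : ℂ) • ⇑(hM.eigenvectorBasis k) := by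
      rw [hM.mulVec_eigenvectorBasis k]
      ext j
      simp
    have hQ : (Q * U) i k = (Q *ᵥ ⇑(hM.eigenvectorBasis k)) i := rfl
    rw [Matrix.mul_diagonal, hQ]
    split_ifs with h
    · rw [hlt _ _ heig h, hcol, mul_one]
    · rw [hge _ _ heig (not_lt.1 h), mul_zero]; rfl
  rw [← key, Matrix.mul_assoc, hUU, Matrix.mul_one]

/-- The matrix of `ψ ↦ X ψ ⊗ |0⟩ + Y ψ ⊗ |1⟩`. -/
def qubitColumn (X Y : Matrix I I ℂ) : Matrix (I × Fin 2) I ℂ :=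
  fun p i => if p.2 = 0 then X p.1 i else Y p.1 i

omit [DecidableEq I] in
theorem qubitColumn_mul (X Y Z : Matrix I I ℂ) :
    qubitColumn X Y * Z = qubitColumn (X * Z) (Y * Z) := by
  ext ⟨p, t⟩ i
  fin_cases t <;> simp [qubitColumn, Matrix.mul_apply]

omit [DecidableEq I] in
theorem qubitColumn_conjTranspose_mul (X Y X' Y' : Matrix I I ℂ) :
    (qubitColumn X Y)ᴴ * qubitColumn X' Y' = Xᴴ * X' + Yᴴ * Y' := by
  ext i j
  simp [qubitColumn, Matrix.mul_apply, Fintype.sum_prod_type, Finset.sum_add_distrib]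

omit [Fintype I] [DecidableEq I] in
theorem qubitColumn_add (X Y X' Y' : Matrix I I ℂ) :
    qubitColumn X Y + qubitColumn X' Y' = qubitColumn (X + X') (Y + Y') := by
  ext ⟨p, t⟩ i
  fin_cases t <;> simp [qubitColumn]

omit [Fintype I] [DecidableEq I] in
theorem qubitColumn_sub (X Y X' Y' : Matrix I I ℂ) :
    qubitColumn X Y - qubitColumn X' Y' = qubitColumn (X - X') (Y - Y') := by
  ext ⟨p, t⟩ i
  fin_cases t <;> simp [qubitColumn]

omit [Fintype I] [DecidableEq I] in
theorem smul_qubitColumn (c : ℂ) (X Y : Matrix I I ℂ) :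
    c • qubitColumn X Y = qubitColumn (c • X) (c • Y) := by
  ext ⟨p, t⟩ i
  fin_cases t <;> simp [qubitColumn]

omit [Fintype I] in
theorem prodIso_anc0 : prodIso (I := I) anc0 = qubitColumn 1 0 := by
  ext ⟨p, t⟩ i
  fin_cases t <;> simp [qubitColumn, prodIso, anc0, Matrix.one_apply]

omit [DecidableEq I] in
theorem kronecker_mul_qubitColumn (A X Y : Matrix I I ℂ) (N : Matrix (Fin 2) (Fin 2) ℂ) :
    (A ⊗ₖ N) * qubitColumn X Y
      = qubitColumn (N 0 0 • (A * X) + N 0 1 • (A * Y)) (N 1 0 • (A * X) + N 1 1 • (A * Y)) := by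
  ext ⟨p, t⟩ i
  fin_cases t <;>
  · simp only [qubitColumn, Matrix.mul_apply, Fintype.sum_prod_type, Fin.sum_univ_two,
      Matrix.kroneckerMap_apply, Finset.sum_add_distrib, Matrix.add_apply, Matrix.smul_apply,
      smul_eq_mul, Finset.mul_sum]
    simp [mul_comm, mul_left_comm, mul_assoc]

theorem qubitColumn_decomposition (W : Matrix I I ℂ) :
    qubitColumn (0 : Matrix I I ℂ) 1 * (qubitColumn (-Wᴴ) 1)ᴴ
      + qubitColumn 1 W * (qubitColumn (1 : Matrix I I ℂ) 0)ᴴ = 1 := by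
  ext ⟨p, t⟩ ⟨q, v⟩
  fin_cases t <;> fin_cases v <;>
    simp [qubitColumn, Matrix.mul_apply, Matrix.one_apply, apply_ite]

omit [DecidableEq I] in
theorem norm_le_one_of_conjTranspose_mul_self {T : Matrix I J ℂ} (h : Tᴴ * T = 1) :
    ‖T‖ ≤ 1 := by
  have h1 := Matrix.l2_opNorm_conjTranspose_mul_self T
  rw [h] at h1
  rcases subsingleton_or_nontrivial (Matrix J J ℂ) with hs | hs
  · rw [Subsingleton.elim (1 : Matrix J J ℂ) 0, norm_zero] at h1
    nlinarith [norm_nonneg T]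
  · rw [norm_one] at h1
    nlinarith [norm_nonneg T]

theorem norm_qubitColumn_le (X Y : Matrix I I ℂ) : ‖qubitColumn X Y‖ ≤ ‖X‖ + ‖Y‖ := by
  have h1 : qubitColumn X Y = qubitColumn (1 : Matrix I I ℂ) 0 * X
      + qubitColumn (0 : Matrix I I ℂ) 1 * Y := by
    rw [qubitColumn_mul, qubitColumn_mul, qubitColumn_add]
    simp
  have hl : ‖qubitColumn (1 : Matrix I I ℂ) 0‖ ≤ 1 :=
    norm_le_one_of_conjTranspose_mul_self (by simp [qubitColumn_conjTranspose_mul])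
  have hr : ‖qubitColumn 0 (1 : Matrix I I ℂ)‖ ≤ 1 :=
    norm_le_one_of_conjTranspose_mul_self (by simp [qubitColumn_conjTranspose_mul])
  rw [h1]
  refine (norm_add_le _ _).trans (add_le_add ?_ ?_)
  · exact (Matrix.l2_opNorm_mul _ _).trans (mul_le_of_le_one_left (norm_nonneg _) hl)
  · exact (Matrix.l2_opNorm_mul _ _).trans (mul_le_of_le_one_left (norm_nonneg _) hr)

theorem norm_le_norm_kronecker_Xmat (B : Matrix I I ℂ) : ‖B‖ ≤ ‖B ⊗ₖ Xmat‖ := by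
  have h1 : B = (qubitColumn (1 : Matrix I I ℂ) 0)ᴴ
      * ((B ⊗ₖ Xmat) * qubitColumn (0 : Matrix I I ℂ) 1) := by
    simp [kronecker_mul_qubitColumn, qubitColumn_conjTranspose_mul, Xmat]
  have hl : ‖(qubitColumn (1 : Matrix I I ℂ) 0)ᴴ‖ ≤ 1 := by
    rw [Matrix.l2_opNorm_conjTranspose]
    exact norm_le_one_of_conjTranspose_mul_self (by simp [qubitColumn_conjTranspose_mul])
  have hr : ‖qubitColumn 0 (1 : Matrix I I ℂ)‖ ≤ 1 :=
    norm_le_one_of_conjTranspose_mul_self (by simp [qubitColumn_conjTranspose_mul])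
  calc ‖B‖ = _ := congrArg norm h1
    _ ≤ _ := (Matrix.l2_opNorm_mul _ _).trans (mul_le_of_le_one_left (norm_nonneg _) hl)
    _ ≤ _ := (Matrix.l2_opNorm_mul _ _).trans (mul_le_of_le_one_right (norm_nonneg _) hr)

theorem mul_conjTranspose_eq_specProjBelow {H : Matrix J J ℂ} {T V X : Matrix J I ℂ}
    {Y : Matrix I J ℂ} {K N : Matrix I I ℂ} {D : ℝ} (hH : Hᴴ = H) (hTT : Tᴴ * T = 1)
    (hT : H * T = T * K) (hK : ‖K‖ < D) (hV : H * V = V * (((2 * D : ℝ) : ℂ) • 1 + N))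
    (hN : ‖N‖ < D) (hdec : X * Vᴴ + T * Y = 1) : T * Tᴴ = specProjBelow H D := by
  have hKH : Kᴴ = K := by
    have h : K = Tᴴ * (H * T) := by rw [hT, ← Matrix.mul_assoc, hTT, Matrix.one_mul]
    rw [h, Matrix.conjTranspose_mul, Matrix.conjTranspose_mul, hH,
      Matrix.conjTranspose_conjTranspose, Matrix.mul_assoc]
  have hTH : Tᴴ * H = K * Tᴴ := by
    have h := congrArg Matrix.conjTranspose hT
    rwa [Matrix.conjTranspose_mul, Matrix.conjTranspose_mul, hH, hKH] at h
  have hVH : Nᴴ * Vᴴ = Vᴴ * H - ((2 * D : ℝ) : ℂ) • Vᴴ := by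
    have h := congrArg Matrix.conjTranspose hV
    rw [Matrix.conjTranspose_mul, Matrix.conjTranspose_mul, hH,
      Matrix.conjTranspose_add, Matrix.add_mul, Matrix.conjTranspose_smul,
      Matrix.conjTranspose_one, Matrix.smul_mul, Matrix.one_mul, Complex.star_def,
      Complex.conj_ofReal] at h
    rw [h, add_sub_cancel_left]
  refine specProjBelow_eq hH ?_ ?_
  · intro u c hu hc
    have hy : Vᴴ *ᵥ u = 0 := by
      by_contra hne
      have h : Nᴴ *ᵥ (Vᴴ *ᵥ u) = ((c - 2 * D : ℝ) : ℂ) • (Vᴴ *ᵥ u) := by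
        rw [Matrix.mulVec_mulVec, hVH, Matrix.sub_mulVec, ← Matrix.mulVec_mulVec, hu,
          Matrix.mulVec_smul, Matrix.smul_mulVec, Complex.ofReal_sub, sub_smul]
      have h1 := norm_le_norm_of_mulVec_eq_smul h hne
      rw [Matrix.l2_opNorm_conjTranspose, Complex.norm_real] at h1
      linarith [(abs_le.1 h1).1]
    have hu0 : u = T *ᵥ (Y *ᵥ u) := by
      conv_lhs => rw [← Matrix.one_mulVec u, ← hdec, Matrix.add_mulVec, ← Matrix.mulVec_mulVec,
        hy, Matrix.mulVec_zero, zero_add, ← Matrix.mulVec_mulVec]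
    rw [hu0, Matrix.mulVec_mulVec, Matrix.mul_assoc, hTT, Matrix.mul_one]
  · intro u c hu hc
    rw [← Matrix.mulVec_mulVec]
    suffices h : Tᴴ *ᵥ u = 0 by rw [h, Matrix.mulVec_zero]
    by_contra hne
    have h : K *ᵥ (Tᴴ *ᵥ u) = (c : ℂ) • (Tᴴ *ᵥ u) := by
      rw [Matrix.mulVec_mulVec, ← hTH, ← Matrix.mulVec_mulVec, hu, Matrix.mulVec_smul]
    have h1 := norm_le_norm_of_mulVec_eq_smul h hne
    rw [Complex.norm_real] at h1
    linarith [le_abs_self c, Real.norm_eq_abs c]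

/-- The Hamiltonian `s² |1⟩⟨1| + A ⊗ 1 + s B ⊗ X` on a system with one ancilla qubit. -/
noncomputable def ancillaHamiltonian (A B : Matrix I I ℂ) (s : ℝ) :
    Matrix (I × Fin 2) (I × Fin 2) ℂ :=
  ((s ^ 2 : ℝ) : ℂ) • ((1 : Matrix I I ℂ) ⊗ₖ proj1) + A ⊗ₖ (1 : Matrix (Fin 2) (Fin 2) ℂ)
    + (s : ℂ) • (B ⊗ₖ Xmat)

omit [Fintype I] in
theorem ancillaHamiltonian_conjTranspose {A B : Matrix I I ℂ} (hA : Aᴴ = A) (hB : Bᴴ = B)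
    (s : ℝ) : (ancillaHamiltonian A B s)ᴴ = ancillaHamiltonian A B s := by
  have hp : proj1ᴴ = proj1 := by ext i j; fin_cases i <;> fin_cases j <;> simp [proj1]
  have hx : Xmatᴴ = Xmat := by ext i j; fin_cases i <;> fin_cases j <;> simp [Xmat]
  simp [ancillaHamiltonian, Matrix.conjTranspose_add, Matrix.conjTranspose_smul,
    Matrix.conjTranspose_kronecker, hA, hB, hp, hx]

theorem ancillaHamiltonian_mul_qubitColumn (A B X Y : Matrix I I ℂ) (s : ℝ) :
    ancillaHamiltonian A B s * qubitColumn X Y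
      = qubitColumn (A * X + (s : ℂ) • (B * Y))
        ((s : ℂ) • (B * X) + ((s ^ 2 : ℝ) : ℂ) • Y + A * Y) := by
  rw [ancillaHamiltonian, Matrix.add_mul, Matrix.add_mul, Matrix.smul_mul, Matrix.smul_mul,
    kronecker_mul_qubitColumn, kronecker_mul_qubitColumn, kronecker_mul_qubitColumn,
    smul_qubitColumn, smul_qubitColumn, qubitColumn_add, qubitColumn_add]
  congr 1
  · simp [proj1, Xmat]
  · simp [proj1, Xmat]; abel

theorem ancillaHamiltonian_mul_complement {A B W : Matrix I I ℂ} (hA : Aᴴ = A) (hB : Bᴴ = B)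
    {s : ℝ}
    (hric : (s : ℂ) • B + ((s ^ 2 : ℝ) : ℂ) • W + A * W = W * (A + (s : ℂ) • (B * W))) :
    ancillaHamiltonian A B s * qubitColumn (-Wᴴ) 1
      = qubitColumn (-Wᴴ) 1 * (((s ^ 2 : ℝ) : ℂ) • 1 + (A - (s : ℂ) • (B * Wᴴ))) := by
  have ricH : (s : ℂ) • B + ((s ^ 2 : ℝ) : ℂ) • Wᴴ + Wᴴ * A
      = (A + (s : ℂ) • (Wᴴ * B)) * Wᴴ := by
    have h := congrArg Matrix.conjTranspose hric
    simpa [Matrix.conjTranspose_add, Matrix.conjTranspose_mul, Matrix.conjTranspose_smul, hA, hB,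
      -Complex.ofReal_pow] using h
  rw [ancillaHamiltonian_mul_qubitColumn, qubitColumn_mul]
  congr 1
  · have : (s : ℂ) • B = (A + (s : ℂ) • (Wᴴ * B)) * Wᴴ
        - (((s ^ 2 : ℝ) : ℂ) • Wᴴ + Wᴴ * A) := by rw [← ricH]; abel
    rw [Matrix.mul_one, this]
    simp only [Matrix.mul_add, Matrix.add_mul, Matrix.mul_sub, Matrix.smul_mul, Matrix.mul_smul,
      Matrix.neg_mul, Matrix.mul_neg, Matrix.mul_one, Matrix.mul_assoc,
      smul_neg]
    abel
  · simp only [Matrix.mul_one, Matrix.one_mul, Matrix.mul_neg, smul_neg]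
    abel

theorem isSimulation_ancillaHamiltonian {A B : Matrix I I ℂ} (hA : Aᴴ = A) (hB : Bᴴ = B)
    {L s ε η : ℝ} (hL : 1 ≤ L) (hs : 8 * L ≤ s) (hAL : ‖A‖ ≤ L) (hBL : ‖B‖ ≤ L)
    (hε : 32 * L ^ 4 ≤ ε * s ^ 2) (hη : 4 * L ≤ η * s) :
    IsSimulation (ancillaHamiltonian A B s) (A - B * B) anc0 (s ^ 2 / 2) η ε := by
  have hs0 : 0 < s := by linarith
  obtain ⟨W, hW, hfix⟩ := exists_riccati_solution hL hs hAL hBL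
  obtain ⟨S, R, hS, hRS, hRR, hS1, hSd, hRd⟩ := exists_sqrt_one_add_star_mul_self W
  rw [Matrix.star_eq_conjTranspose] at hS hRR
  have hSR : S * R = 1 := mul_eq_one_comm.1 hRS
  have hric := riccati_equation hs0 hfix
  have hKn := norm_conj_lt hL hs hAL hBL hW hS1 hSd hRd
  have hKd := norm_conj_sub_effective_le hL hs hAL hBL hW hfix hS1 hSd hRd
  have hNn := norm_sub_smul_mul_lt hL hs hAL hBL
    (w := Wᴴ) (by rwa [Matrix.l2_opNorm_conjTranspose])
  have hH := ancillaHamiltonian_conjTranspose hA hB s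
  have hV := ancillaHamiltonian_mul_complement hA hB hric
  have hT0 : ancillaHamiltonian A B s * qubitColumn 1 W
      = qubitColumn 1 W * (A + (s : ℂ) • (B * W)) := by
    rw [ancillaHamiltonian_mul_qubitColumn, qubitColumn_mul, Matrix.mul_one, Matrix.mul_one,
      Matrix.one_mul, hric]
  generalize A + (s : ℂ) • (B * W) = K at *
  generalize A - (s : ℂ) • (B * Wᴴ) = N at *
  generalize ancillaHamiltonian A B s = H at *
  have hTT : (qubitColumn 1 W * S)ᴴ * (qubitColumn 1 W * S) = 1 := by
    rw [Matrix.conjTranspose_mul, hS]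
    calc S * (qubitColumn 1 W)ᴴ * (qubitColumn 1 W * S)
        = S * ((qubitColumn 1 W)ᴴ * qubitColumn 1 W) * S := by simp only [Matrix.mul_assoc]
      _ = (S * R) * (R * S) := by
        rw [qubitColumn_conjTranspose_mul, Matrix.conjTranspose_one, Matrix.mul_one, ← hRR]
        simp only [Matrix.mul_assoc]
      _ = 1 := by rw [hSR, hRS, Matrix.mul_one]
  have hHT : H * (qubitColumn 1 W * S) = qubitColumn 1 W * S * (R * K * S) := by
    rw [← Matrix.mul_assoc, hT0]
    simp only [Matrix.mul_assoc]
    rw [← Matrix.mul_assoc S R, hSR, Matrix.one_mul]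
  have hdec : qubitColumn (0 : Matrix I I ℂ) 1 * (qubitColumn (-Wᴴ) 1)ᴴ
      + qubitColumn 1 W * S * (R * (qubitColumn (1 : Matrix I I ℂ) 0)ᴴ) = 1 := by
    rw [← qubitColumn_decomposition W, Matrix.mul_assoc, ← Matrix.mul_assoc S R, hSR,
      Matrix.one_mul]
  have hTd : ‖qubitColumn 1 W * S - qubitColumn 1 0‖ ≤ η := by
    have hη' : 4 * L / s ≤ η := (div_le_iff₀ hs0).2 hη
    have hr0 : 0 ≤ 2 * L / s := by positivity
    have hr1 : 2 * L / s ≤ 1 := by rw [div_le_one hs0]; linarith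
    have hWS : ‖W * S‖ ≤ 2 * L / s * 1 := norm_mul_le_of_le hW hS1
    have hW2 : ‖W‖ ^ 2 ≤ (2 * L / s) ^ 2 := by gcongr
    rw [qubitColumn_mul, qubitColumn_sub, Matrix.one_mul, sub_zero]
    calc _ ≤ (2 * L / s) ^ 2 + 2 * L / s * 1 :=
          (norm_qubitColumn_le _ _).trans (add_le_add (hSd.trans hW2) hWS)
      _ ≤ 2 * L / s + 2 * L / s := by nlinarith
      _ = 4 * L / s := by ring
      _ ≤ η := hη'
  generalize R * K * S = K' at *
  generalize qubitColumn 1 W * S = T at *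
  have hspec : T * Tᴴ = specProjBelow H (s ^ 2 / 2) :=
    mul_conjTranspose_eq_specProjBelow hH hTT hHT hKn
      (by rw [hV, mul_div_cancel₀ _ (two_ne_zero' ℝ)]) hNn hdec
  refine ⟨T, by simp [anc0, dotProduct], hTT, hspec, ?_, ?_⟩
  · rwa [opNorm_eq_norm, prodIso_anc0]
  · rw [opNorm_eq_norm, ← hspec]
    have hT1 : ‖T‖ ≤ 1 := norm_le_one_of_conjTranspose_mul_self hTT
    have hTH1 : ‖Tᴴ‖ ≤ 1 := by rwa [Matrix.l2_opNorm_conjTranspose]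
    have e : T * Tᴴ * H * (T * Tᴴ) - T * (A - B * B) * Tᴴ
        = T * (K' - (A - B * B)) * Tᴴ := by
      have h : T * Tᴴ * H * (T * Tᴴ) = T * K' * Tᴴ := by
        rw [← Matrix.mul_assoc, Matrix.mul_assoc (T * Tᴴ), hHT, ← Matrix.mul_assoc,
          Matrix.mul_assoc T Tᴴ T, hTT, Matrix.mul_one]
      rw [h, ← Matrix.sub_mul, ← Matrix.mul_sub]
    rw [e]
    refine (Matrix.l2_opNorm_mul _ _).trans
      ((mul_le_of_le_one_right (norm_nonneg _) hTH1).trans ?_)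
    refine (Matrix.l2_opNorm_mul _ _).trans
      ((mul_le_of_le_one_left (norm_nonneg _) hT1).trans (hKd.trans ?_))
    exact (div_le_iff₀ (by positivity)).2 hε

end Spectral

section Qubits

variable {m : ℕ}

theorem oneQubitOp_mulVec (i : Fin m) (E : Matrix (Fin 2) (Fin 2) ℂ) (f : QIdx m → ℂ)
    (x : QIdx m) :
    (oneQubitOp m i E *ᵥ f) x = ∑ b, E (x i) b * f (Function.update x i b) := by
  symm
  refine Finset.sum_of_injOn (fun b => Function.update x i b) ?_ (by simp) ?_ ?_
  · exact fun a _ b _ h => Function.update_injective x i h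
  · intro y _ hy
    have : ¬ ∀ k, k ≠ i → x k = y k := by
      intro h
      refine hy ⟨y i, by simp, ?_⟩
      ext1 k
      rcases eq_or_ne k i with rfl | hk
      · simp
      · simp [hk, h k hk]
    simp [oneQubitOp, this]
  · intro b _
    have : ∀ k, k ≠ i → x k = Function.update x i b k := fun k hk => by simp [hk]
    simp only [oneQubitOp, if_pos this]
    simp

theorem oneQubitOp_conjTranspose (i : Fin m) (E : Matrix (Fin 2) (Fin 2) ℂ) :
    (oneQubitOp m i E)ᴴ = oneQubitOp m i Eᴴ := by
  ext x y
  simp only [oneQubitOp, Matrix.conjTranspose_apply, eq_comm, star_mul', apply_ite star, star_one,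
    star_zero]

theorem oneQubitOp_mul_self (i : Fin m) {E : Matrix (Fin 2) (Fin 2) ℂ} (h : E * E = 1) :
    oneQubitOp m i E * oneQubitOp m i E = 1 := by
  refine Matrix.ext_of_mulVec_single fun y => ?_
  generalize (Pi.single y 1 : QIdx m → ℂ) = f
  ext x
  have h' : ∀ c, E (x i) 0 * E 0 c + E (x i) 1 * E 1 c = (1 : Matrix (Fin 2) (Fin 2) ℂ) (x i) c := by
    intro c
    rw [← h, Matrix.mul_apply, Fin.sum_univ_two]
  rw [← Matrix.mulVec_mulVec, oneQubitOp_mulVec, Matrix.one_mulVec]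
  simp only [oneQubitOp_mulVec, Fin.sum_univ_two, Function.update_self, Function.update_idem]
  have e : f x = ∑ c, (1 : Matrix (Fin 2) (Fin 2) ℂ) (x i) c * f (Function.update x i c) := by
    simp [Matrix.one_apply]
  rw [e, Fin.sum_univ_two, ← h' 0, ← h' 1]
  ring

theorem oneQubitOp_commute {i j : Fin m} (hij : i ≠ j) (E F : Matrix (Fin 2) (Fin 2) ℂ) :
    oneQubitOp m i E * oneQubitOp m j F = oneQubitOp m j F * oneQubitOp m i E := by
  refine Matrix.ext_of_mulVec_single fun y => ?_
  generalize (Pi.single y 1 : QIdx m → ℂ) = f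
  ext x
  rw [← Matrix.mulVec_mulVec, ← Matrix.mulVec_mulVec, oneQubitOp_mulVec, oneQubitOp_mulVec]
  simp only [oneQubitOp_mulVec, Fin.sum_univ_two, Function.update_of_ne hij,
    Function.update_of_ne hij.symm, Function.update_comm hij]
  ring

end Qubits

/-- triangle gadget.  There is a universal `c₀ > 0` such that for
Hermitian involutions `P_A, P_B, P_C` on three distinct qubits and reals `α_ab, α_ac`,
adjoining one ancilla `t` and setting `H₀ = |1⟩⟨1|_t`,
`H₁ = H_else + α_ab α_ac P_B P_C + (1 + α_ab² + α_ac²)/2`,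
`H₂ = (−P_A + α_ab P_B + α_ac P_C)⊗X_t/√2`, the Hamiltonian `H̃ = ΔH₀ + H₁ + √Δ H₂` is a
`(Δ/2, η, ε)`-simulation of `H_else + α_ab P_A P_B + α_ac P_A P_C` (product encoding,
ancilla state `|0⟩_t`) whenever `ε, η ∈ (0,1]` and `Δ ≥ c₀(Λ⁶/ε² + Λ²/η²)`,
`Λ = max(‖H₁‖, ‖H₂‖, 1)`. -/
theorem triangle_gadget :
    ∃ c₀ : ℝ, 0 < c₀ ∧
    ∀ (m : ℕ) (Helse : QOp m), Helseᴴ = Helse →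
    ∀ (qA qB qC : Fin m), qA ≠ qB → qA ≠ qC → qB ≠ qC →
    ∀ (pA pB pC : Matrix (Fin 2) (Fin 2) ℂ),
      pAᴴ = pA → pBᴴ = pB → pCᴴ = pC →
      pA * pA = 1 → pB * pB = 1 → pC * pC = 1 →
    ∀ (αab αac : ℝ),
    let PA : QOp m := oneQubitOp m qA pA
    let PB : QOp m := oneQubitOp m qB pB
    let PC : QOp m := oneQubitOp m qC pC
    let H₁ : QOp m := Helse + ((αab * αac : ℝ) : ℂ) • (PB * PC)
      + (((1 + αab ^ 2 + αac ^ 2) / 2 : ℝ) : ℂ) • (1 : QOp m)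
    let H₂ : Matrix (QIdx m × Fin 2) (QIdx m × Fin 2) ℂ :=
      (((Real.sqrt 2)⁻¹ : ℝ) : ℂ) •
        ((-PA + (αab : ℂ) • PB + (αac : ℂ) • PC) ⊗ₖ Xmat)
    let Λ : ℝ := max (opNorm H₁) (max (opNorm H₂) 1)
    ∀ ε η : ℝ, ε ∈ Set.Ioc (0 : ℝ) 1 → η ∈ Set.Ioc (0 : ℝ) 1 →
      ∀ Δ : ℝ, c₀ * (Λ ^ 6 / ε ^ 2 + Λ ^ 2 / η ^ 2) ≤ Δ →
        IsSimulation
          ((Δ : ℂ) • ((1 : QOp m) ⊗ₖ proj1) + H₁ ⊗ₖ (1 : Matrix (Fin 2) (Fin 2) ℂ)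
            + ((Real.sqrt Δ : ℝ) : ℂ) • H₂)
          (Helse + (αab : ℂ) • (PA * PB) + (αac : ℂ) • (PA * PC)) anc0 (Δ / 2) η ε := by
  refine ⟨64, by norm_num, ?_⟩
  intro m Helse hHelse qA qB qC hAB hAC hBC pA pB pC hpA hpB hpC hpA2 hpB2 hpC2 αab αac
    PA PB PC H₁ H₂ Λ ε η hε hη Δ hΔ
  have hPA : PAᴴ = PA := by rw [oneQubitOp_conjTranspose, hpA]
  have hPB : PBᴴ = PB := by rw [oneQubitOp_conjTranspose, hpB]
  have hPC : PCᴴ = PC := by rw [oneQubitOp_conjTranspose, hpC]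
  have hPA2 : PA * PA = 1 := oneQubitOp_mul_self qA hpA2
  have hPB2 : PB * PB = 1 := oneQubitOp_mul_self qB hpB2
  have hPC2 : PC * PC = 1 := oneQubitOp_mul_self qC hpC2
  have hcAB : PB * PA = PA * PB := oneQubitOp_commute hAB.symm pB pA
  have hcAC : PC * PA = PA * PC := oneQubitOp_commute hAC.symm pC pA
  have hcBC : PC * PB = PB * PC := oneQubitOp_commute hBC.symm pC pB
  clear_value PA PB PC
  set B : QOp m := (((Real.sqrt 2)⁻¹ : ℝ) : ℂ) • (-PA + (αab : ℂ) • PB + (αac : ℂ) • PC) with hB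
  have hH₂ : H₂ = B ⊗ₖ Xmat := by rw [hB, Matrix.smul_kronecker]
  have hH₁ : H₁ᴴ = H₁ := by
    simp only [H₁, Matrix.conjTranspose_add, Matrix.conjTranspose_smul, Matrix.conjTranspose_mul,
      Matrix.conjTranspose_one, hHelse, hPB, hPC, hcBC, Complex.star_def, Complex.conj_ofReal]
  have hBH : Bᴴ = B := by
    simp only [hB, Matrix.conjTranspose_add, Matrix.conjTranspose_smul, Matrix.conjTranspose_neg,
      hPA, hPB, hPC, Complex.star_def, Complex.conj_ofReal]
  have hBB : B * B = (1 / 2 : ℂ) • ((1 + (αab : ℂ) ^ 2 + (αac : ℂ) ^ 2) • (1 : QOp m)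
      - (2 * (αab : ℂ)) • (PA * PB) - (2 * (αac : ℂ)) • (PA * PC)
      + (2 * (αab : ℂ) * αac) • (PB * PC)) := by
    have h2 : (((Real.sqrt 2)⁻¹ : ℝ) : ℂ) * (((Real.sqrt 2)⁻¹ : ℝ) : ℂ) = 1 / 2 := by
      rw [← Complex.ofReal_mul, ← mul_inv, Real.mul_self_sqrt (by norm_num)]
      norm_num
    rw [hB, Matrix.smul_mul, Matrix.mul_smul, smul_smul, h2]
    congr 1
    simp only [Matrix.add_mul, Matrix.mul_add, Matrix.neg_mul, Matrix.mul_neg, Matrix.smul_mul,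
      Matrix.mul_smul, hPA2, hPB2, hPC2, hcAB, hcAC, hcBC]
    module
  have htarget : Helse + (αab : ℂ) • (PA * PB) + (αac : ℂ) • (PA * PC) = H₁ - B * B := by
    rw [hBB]
    simp only [H₁]
    push_cast
    module
  have hΛ : 1 ≤ Λ := (le_max_right _ _).trans (le_max_right _ _)
  have hH₁Λ : opNorm H₁ ≤ Λ := le_max_left _ _
  have hBΛ : opNorm B ≤ Λ := by
    have h : opNorm B ≤ opNorm H₂ := by
      rw [hH₂]; exact norm_le_norm_kronecker_Xmat B
    exact h.trans ((le_max_left _ _).trans (le_max_right _ _))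
  obtain ⟨hε0, hε1⟩ := hε
  obtain ⟨hη0, hη1⟩ := hη
  have hΔε : 64 * (Λ ^ 6 / ε ^ 2) ≤ Δ := by
    have : 0 ≤ Λ ^ 2 / η ^ 2 := by positivity
    linarith
  have hΔη : 64 * (Λ ^ 2 / η ^ 2) ≤ Δ := by
    have : 0 ≤ Λ ^ 6 / ε ^ 2 := by positivity
    linarith
  have hΔ0 : 0 ≤ Δ := le_trans (by positivity) hΔε
  have hηs : 8 * Λ ≤ η * Real.sqrt Δ := by
    rw [← div_le_iff₀' hη0]
    refine Real.le_sqrt_of_sq_le (le_trans (le_of_eq ?_) hΔη)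
    ring
  have hss : Real.sqrt Δ ^ 2 = Δ := Real.sq_sqrt hΔ0
  have hs : 8 * Λ ≤ Real.sqrt Δ :=
    hηs.trans (mul_le_of_le_one_left (Real.sqrt_nonneg _) hη1)
  have hεs : 32 * Λ ^ 4 ≤ ε * Real.sqrt Δ ^ 2 := by
    rw [hss, ← div_le_iff₀' hε0]
    refine le_trans ?_ hΔε
    rw [mul_div_assoc]
    have h4 : Λ ^ 4 ≤ Λ ^ 6 := pow_le_pow_right₀ hΛ (by norm_num)
    have he : ε ^ 2 ≤ ε := by nlinarith
    have : Λ ^ 4 / ε ≤ Λ ^ 6 / ε ^ 2 := by gcongr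
    have : 0 ≤ Λ ^ 4 / ε := by positivity
    linarith
  have key := isSimulation_ancillaHamiltonian hH₁ hBH hΛ hs hH₁Λ hBΛ hεs
    (η := η) (by linarith)
  rw [ancillaHamiltonian, hss] at key
  rw [htarget, hH₂]
  exact key

end QSim
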